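/- arXiv:1012.1573 — 5 statements merged into one kernel-verified Lean document; each statement's English description precedes it below -/
import Mathlib

section
/- Let M be an n×n P-matrix. Then M is a K-matrix (i.e., additionally all off-diagonal entries of M are non-positive) if and only if for every vector q ∈ ℝ^n that is nondegenerate for M, the unique-sink orientation of the n-cube induced by LCP(M,q) is locally uniform. -/
open Matrix BigOperators

/-- A vertex of the `n`-cube: a bit vector of length `n`. -/
abbrev Vertex (n : ℕ) := Fin n → Bool

/-- An orientation of the `n`-cube, given by its "out-map":
`φ v i = true` means that the edge `{v, v ⊕ i}` is directed from `v` to `v ⊕ i`. -/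
abbrev CubeOrientation (n : ℕ) := Vertex n → Fin n → Bool

/-- `v ⊕ i`: flip the `i`-th bit of `v`. -/
def vflip {n : ℕ} (v : Vertex n) (i : Fin n) : Vertex n :=
  Function.update v i (!(v i))

/-- `u` belongs to the subcube with base vertex `v` and coordinate set `C`. -/
def InSubcube {n : ℕ} (v : Vertex n) (C : Finset (Fin n)) (u : Vertex n) : Prop :=
  ∀ j, j ∉ C → u j = v j

/-- `u` is a sink of the subcube `(v, C)`: all subcube edges at `u` are incoming. -/
def IsSink {n : ℕ} (φ : CubeOrientation n) (v : Vertex n) (C : Finset (Fin n))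
    (u : Vertex n) : Prop :=
  InSubcube v C u ∧ ∀ i ∈ C, φ u i = false

/-- `u` is a source of the subcube `(v, C)`: all subcube edges at `u` are outgoing. -/
def IsSource {n : ℕ} (φ : CubeOrientation n) (v : Vertex n) (C : Finset (Fin n))
    (u : Vertex n) : Prop :=
  InSubcube v C u ∧ ∀ i ∈ C, φ u i = true

/-- Unique-sink orientation: every subcube has a unique sink. -/
def IsUSO {n : ℕ} (φ : CubeOrientation n) : Prop :=
  ∀ (v : Vertex n) (C : Finset (Fin n)), ∃! u, IsSink φ v C u

/-- One directed step along an edge of the orientation. -/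
def OrientStep {n : ℕ} (φ : CubeOrientation n) (u w : Vertex n) : Prop :=
  ∃ i, φ u i = true ∧ w = vflip u i

/-- Acyclicity: no directed cycle. -/
def IsAcyclic {n : ℕ} (φ : CubeOrientation n) : Prop :=
  ∀ u, ¬ Relation.TransGen (OrientStep φ) u u

/-- Local uniformity of an orientation. -/
def LocallyUniform {n : ℕ} (φ : CubeOrientation n) : Prop :=
  (∀ (u : Vertex n) (i j : Fin n), i ≠ j → u i = false → u j = false →
      φ u i = true → φ u j = true →
      φ (vflip u i) j = true ∧ φ (vflip u j) i = true) ∧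
  (∀ (u : Vertex n) (i j : Fin n), i ≠ j → u i = false → u j = false →
      φ (vflip u i) i = true → φ (vflip u j) j = true →
      φ (vflip (vflip u i) j) j = true ∧ φ (vflip (vflip u j) i) i = true)

/-- `p` is a directed path from `s` to `t` inside the subcube `(v, C)`. -/
def IsDirPathIn {n : ℕ} (φ : CubeOrientation n) (v : Vertex n) (C : Finset (Fin n))
    (s t : Vertex n) (p : List (Vertex n)) : Prop :=
  p.head? = some s ∧ p.getLast? = some t ∧ p.Nodup ∧
  (∀ u ∈ p, InSubcube v C u) ∧
  p.Chain' (fun a b => ∃ i ∈ C, φ a i = true ∧ b = vflip a i)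

/-- The Holt–Klee property: in every subcube of dimension `d`, there are `d` directed
paths from the source to the sink, pairwise sharing no vertex besides source and sink. -/
def HoltKlee {n : ℕ} (φ : CubeOrientation n) : Prop :=
  IsUSO φ ∧
  ∀ (v : Vertex n) (C : Finset (Fin n)) (s t : Vertex n),
    IsSource φ v C s → IsSink φ v C t →
    ∃ P : Fin C.card → List (Vertex n),
      (∀ k, IsDirPathIn φ v C s t (P k)) ∧
      ∀ k l, k ≠ l → ∀ u, u ∈ P k → u ∈ P l → u = s ∨ u = t

/-- `φ^{(F)}`: reverse all edges in the coordinates belonging to `F`. -/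
def Reorient {n : ℕ} (φ : CubeOrientation n) (F : Finset (Fin n)) : CubeOrientation n :=
  fun v i => if i ∈ F then φ (vflip v i) i else φ v i

/-- Strong Holt–Klee property. -/
def StronglyHoltKlee {n : ℕ} (φ : CubeOrientation n) : Prop :=
  ∀ F : Finset (Fin n), HoltKlee (Reorient φ F)

/-- A P-matrix: all principal minors are positive. -/
def IsPMatrix {n : ℕ} (M : Matrix (Fin n) (Fin n) ℝ) : Prop :=
  ∀ S : Finset (Fin n), S.Nonempty →
    0 < (M.submatrix (fun i : S => (i : Fin n)) (fun i : S => (i : Fin n))).det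

/-- A Z-matrix: all off-diagonal entries are non-positive. -/
def IsZMatrix {n : ℕ} (M : Matrix (Fin n) (Fin n) ℝ) : Prop :=
  ∀ i j, i ≠ j → M i j ≤ 0

/-- A K-matrix: both a Z-matrix and a P-matrix. -/
def IsKMatrix {n : ℕ} (M : Matrix (Fin n) (Fin n) ℝ) : Prop :=
  IsZMatrix M ∧ IsPMatrix M

/-- The matrix `A_B`: its `s`-th column is the `s`-th column of `-M` if `s ∈ B`,
and the `s`-th column of the identity matrix otherwise. -/
def ABmat {n : ℕ} (M : Matrix (Fin n) (Fin n) ℝ) (B : Finset (Fin n)) :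
    Matrix (Fin n) (Fin n) ℝ :=
  fun r s => if s ∈ B then -(M r s) else if r = s then 1 else 0

/-- The vector `A_B⁻¹ q`. -/
noncomputable def lcpVal {n : ℕ} (M : Matrix (Fin n) (Fin n) ℝ) (q : Fin n → ℝ)
    (B : Finset (Fin n)) : Fin n → ℝ :=
  (ABmat M B)⁻¹ *ᵥ q

/-- `q` is nondegenerate for `M`: `(A_B⁻¹ q)_i ≠ 0` for all `B` and `i`. -/
def Nondegenerate {n : ℕ} (M : Matrix (Fin n) (Fin n) ℝ) (q : Fin n → ℝ) : Prop :=
  ∀ (B : Finset (Fin n)) (i : Fin n), lcpVal M q B i ≠ 0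

/-- `B(v) = {j : v_j = 1}`. -/
def vertexBasis {n : ℕ} (v : Vertex n) : Finset (Fin n) :=
  Finset.univ.filter (fun j => v j = true)

/-- The orientation induced by `LCP(M, q)`: `v → v ⊕ i` iff `(A_{B(v)}⁻¹ q)_i < 0`. -/
noncomputable def inducedOrientation {n : ℕ} (M : Matrix (Fin n) (Fin n) ℝ)
    (q : Fin n → ℝ) : CubeOrientation n :=
  fun v i => decide (lcpVal M q (vertexBasis v) i < 0)

/-- A P-USO: an orientation induced by an LCP with a P-matrix and nondegenerate `q`. -/
def IsPUSO {n : ℕ} (φ : CubeOrientation n) : Prop :=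
  ∃ (M : Matrix (Fin n) (Fin n) ℝ) (q : Fin n → ℝ),
    IsPMatrix M ∧ Nondegenerate M q ∧ φ = inducedOrientation M q

/-- A K-USO: an orientation induced by an LCP with a K-matrix and nondegenerate `q`. -/
def IsKUSO {n : ℕ} (φ : CubeOrientation n) : Prop :=
  ∃ (M : Matrix (Fin n) (Fin n) ℝ) (q : Fin n → ℝ),
    IsKMatrix M ∧ Nondegenerate M q ∧ φ = inducedOrientation M q

/-- The determinant of `A_B` is `(-1)^|B|` times the principal minor of `M` on `B`. -/
lemma det_ABmat {n : ℕ} (M : Matrix (Fin n) (Fin n) ℝ) (B : Finset (Fin n)) :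
    (ABmat M B).det = (-1) ^ B.card *
      (M.submatrix (fun i : B => (i : Fin n)) (fun i : B => (i : Fin n))).det := by
  rw [Matrix.twoBlockTriangular_det' (ABmat M B) (fun i => i ∈ B)]
  · have h1 : (ABmat M B).toSquareBlockProp (fun i => i ∈ B) =
        -(M.submatrix (fun i : B => (i : Fin n)) (fun i : B => (i : Fin n))) := by
      ext r s
      simp [Matrix.toSquareBlockProp, ABmat, s.2]
    have h2 : (ABmat M B).toSquareBlockProp (fun i => ¬ i ∈ B) = 1 := by
      ext r s
      simp [Matrix.toSquareBlockProp, ABmat, s.2, Matrix.one_apply, Subtype.ext_iff]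
    rw [h1, h2, Matrix.det_one, mul_one]
    convert Matrix.det_neg (M.submatrix (fun i : B => (i : Fin n)) (fun i : B => (i : Fin n)))
      using 2
    rw [Fintype.card_coe]
  · intro i hi j hj
    have hij : i ≠ j := fun h => hj (h ▸ hi)
    simp [ABmat, hj, hij]

namespace IsPMatrix

variable {n : ℕ} {M : Matrix (Fin n) (Fin n) ℝ}

lemma neg_one_pow_mul_det_ABmat_pos (hM : IsPMatrix M) (B : Finset (Fin n)) :
    0 < (-1) ^ B.card * (ABmat M B).det := by
  rw [det_ABmat, ← mul_assoc, ← mul_pow]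
  rcases B.eq_empty_or_nonempty with rfl | hB
  · simp
  · simpa using hM B hB

lemma isUnit_det_ABmat (hM : IsPMatrix M) (B : Finset (Fin n)) : IsUnit (ABmat M B).det :=
  isUnit_iff_ne_zero.2 (right_ne_zero_of_mul (hM.neg_one_pow_mul_det_ABmat_pos B).ne')

lemma ABmat_mulVec_lcpVal (hM : IsPMatrix M) (q : Fin n → ℝ) (B : Finset (Fin n)) :
    ABmat M B *ᵥ lcpVal M q B = q := by
  rw [lcpVal, Matrix.mulVec_mulVec, Matrix.mul_nonsing_inv _ (hM.isUnit_det_ABmat B),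
    Matrix.one_mulVec]

lemma lcpVal_eq_of_mulVec_eq (hM : IsPMatrix M) {q x : Fin n → ℝ} {B : Finset (Fin n)}
    (h : ABmat M B *ᵥ x = q) : lcpVal M q B = x := by
  rw [lcpVal, ← h, Matrix.mulVec_mulVec, Matrix.nonsing_inv_mul _ (hM.isUnit_det_ABmat B),
    Matrix.one_mulVec]

/-- The pivot element of a principal pivot step has negative sign. -/
lemma lcpVal_neg_col_self_neg (hM : IsPMatrix M) {B : Finset (Fin n)} {k : Fin n} (hk : k ∉ B) :
    lcpVal M (fun r => -M r k) B k < 0 := by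
  have hc := congrFun (Matrix.det_smul_inv_mulVec_eq_cramer (ABmat M B) (fun r => -M r k)
    (hM.isUnit_det_ABmat B)) k
  have hu : (ABmat M B).updateCol k (fun r => -M r k) = ABmat M (insert k B) := by
    ext r s
    by_cases hs : s = k
    · subst hs; simp [ABmat]
    · simp [ABmat, hs]
  rw [Matrix.cramer_apply, hu, Pi.smul_apply, smul_eq_mul] at hc
  change (ABmat M B).det * lcpVal M (fun r => -M r k) B k = _ at hc
  have h1 := hM.neg_one_pow_mul_det_ABmat_pos B
  have h2 := hM.neg_one_pow_mul_det_ABmat_pos (insert k B)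
  rw [Finset.card_insert_of_notMem hk, ← hc, pow_succ] at h2
  by_contra! h
  have := mul_nonneg h1.le h
  linarith

/-- A principal pivot step exchanging the basis `B` for `insert k B`. -/
lemma lcpVal_eq_pivot (hM : IsPMatrix M) (q : Fin n → ℝ) {B : Finset (Fin n)} {k : Fin n}
    (hk : k ∉ B) :
    lcpVal M q B = lcpVal M q (insert k B) +
      lcpVal M q (insert k B) k • (lcpVal M (fun r => -M r k) B - Pi.single k 1) := by
  apply hM.lcpVal_eq_of_mulVec_eq
  rw [Matrix.mulVec_add, Matrix.mulVec_smul, Matrix.mulVec_sub, hM.ABmat_mulVec_lcpVal,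
    Matrix.mulVec_single_one]
  conv_rhs => rw [← hM.ABmat_mulVec_lcpVal q (insert k B)]
  ext r
  simp only [Pi.add_apply, Pi.smul_apply, Pi.sub_apply, smul_eq_mul, Matrix.mulVec, dotProduct,
    Matrix.col_apply]
  symm
  rw [← sub_eq_iff_eq_add', ← Finset.sum_sub_distrib, Finset.sum_eq_single k]
  · simp only [ABmat, hk, Finset.mem_insert_self, if_true, if_false]
    ring
  · intro s _ hs
    simp [ABmat, hs]
  · simp

lemma lcpVal_pivot_self (hM : IsPMatrix M) (q : Fin n → ℝ) {B : Finset (Fin n)} {k : Fin n}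
    (hk : k ∉ B) :
    lcpVal M q B k = lcpVal M q (insert k B) k * lcpVal M (fun r => -M r k) B k := by
  have h := congrFun (hM.lcpVal_eq_pivot q hk) k
  simp only [Pi.add_apply, Pi.smul_apply, Pi.sub_apply, smul_eq_mul, Pi.single_eq_same] at h
  linarith

lemma lcpVal_pivot_of_ne (hM : IsPMatrix M) (q : Fin n → ℝ) {B : Finset (Fin n)} {k j : Fin n}
    (hk : k ∉ B) (hj : j ≠ k) :
    lcpVal M q B j = lcpVal M q (insert k B) j +
      lcpVal M q (insert k B) k * lcpVal M (fun r => -M r k) B j := by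
  have h := congrFun (hM.lcpVal_eq_pivot q hk) j
  simpa [Pi.single_eq_of_ne hj] using h

lemma lcpVal_insert_self_neg_iff (hM : IsPMatrix M) (q : Fin n → ℝ) {B : Finset (Fin n)}
    {k : Fin n} (hk : k ∉ B) : lcpVal M q (insert k B) k < 0 ↔ 0 < lcpVal M q B k := by
  have hneg := hM.lcpVal_neg_col_self_neg hk
  rw [hM.lcpVal_pivot_self q hk]
  exact ⟨fun h => mul_pos_of_neg_of_neg h hneg, fun h => neg_of_mul_pos_left h hneg.le⟩

/-- The rows of `A_B⁻¹` are nonzero, so generic vectors are nondegenerate. -/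
lemma dense_setOf_nondegenerate (hM : IsPMatrix M) : Dense {q | _root_.Nondegenerate M q} := by
  have hset : {q | _root_.Nondegenerate M q} =
      ⋂ p : Finset (Fin n) × Fin n, {q | lcpVal M q p.1 p.2 ≠ 0} := by
    ext q
    simp [_root_.Nondegenerate]
  rw [hset]
  refine dense_iInter_of_isOpen ?_ ?_
  · rintro ⟨B, i⟩
    refine isOpen_ne_fun ?_ continuous_const
    exact (continuous_apply i).comp (Continuous.matrix_mulVec continuous_const continuous_id)
  · rintro ⟨B, i⟩
    let f : (Fin n → ℝ) →ₗ[ℝ] ℝ := LinearMap.proj i ∘ₗ Matrix.mulVecLin (ABmat M B)⁻¹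
    change Dense ((LinearMap.ker f : Set (Fin n → ℝ))ᶜ)
    rw [← interior_eq_empty_iff_dense_compl, ← Set.not_nonempty_iff_eq_empty]
    intro h
    have htop := Submodule.eq_top_of_nonempty_interior' _ h
    have hmem : ABmat M B *ᵥ Pi.single i 1 ∈ LinearMap.ker f := htop ▸ Submodule.mem_top
    have h0 : lcpVal M (ABmat M B *ᵥ Pi.single i 1) B i = 0 := hmem
    rw [hM.lcpVal_eq_of_mulVec_eq rfl] at h0
    simp at h0

end IsPMatrix

lemma lcpVal_empty {n : ℕ} (M : Matrix (Fin n) (Fin n) ℝ) (q : Fin n → ℝ) :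
    lcpVal M q ∅ = q := by
  have h : ABmat M ∅ = 1 := by
    ext r s
    simp [ABmat, Matrix.one_apply]
  rw [lcpVal, h, inv_one, Matrix.one_mulVec]

/-- Off-diagonal entries keep their sign under principal pivoting of a K-matrix. -/
lemma IsKMatrix.lcpVal_neg_col_nonneg {n : ℕ} {M : Matrix (Fin n) (Fin n) ℝ} (hM : IsKMatrix M)
    (B : Finset (Fin n)) {i j : Fin n} (hi : i ∉ B) (hj : j ∉ B) (hij : j ≠ i) :
    0 ≤ lcpVal M (fun r => -M r i) B j := by
  induction B using Finset.induction_on generalizing i j with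
  | empty =>
    rw [lcpVal_empty]
    exact neg_nonneg.2 (hM.1 j i hij)
  | insert k B hk ih =>
    simp only [Finset.mem_insert, not_or] at hi hj
    have hself := hM.2.lcpVal_pivot_self (fun r => -M r i) hk
    have hne := hM.2.lcpVal_pivot_of_ne (fun r => -M r i) hk hj.1
    have hneg := hM.2.lcpVal_neg_col_self_neg hk
    have h1 := ih hi.2 hk (Ne.symm hi.1)
    have h2 := ih hi.2 hj.2 hij
    have h3 := ih hk hj.2 hj.1
    have h4 : lcpVal M (fun r => -M r i) (insert k B) k ≤ 0 := by
      by_contra! h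
      have := mul_neg_of_pos_of_neg h hneg
      linarith
    have := mul_nonpos_of_nonpos_of_nonneg h4 h3
    linarith

lemma mem_vertexBasis {n : ℕ} {v : Vertex n} {j : Fin n} : j ∈ vertexBasis v ↔ v j = true := by
  simp [vertexBasis]

lemma vertexBasis_vflip {n : ℕ} {u : Vertex n} {i : Fin n} (hi : u i = false) :
    vertexBasis (vflip u i) = insert i (vertexBasis u) := by
  ext s
  rw [Finset.mem_insert, mem_vertexBasis, mem_vertexBasis]
  by_cases hs : s = i
  · subst hs; simp [vflip, hi]
  · simp [vflip, hs]

lemma vflip_apply_of_ne {n : ℕ} (u : Vertex n) {i j : Fin n} (hij : j ≠ i) :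
    vflip u i j = u j :=
  Function.update_of_ne hij _ _

theorem IsKMatrix.locallyUniform {n : ℕ} {M : Matrix (Fin n) (Fin n) ℝ} (hM : IsKMatrix M)
    (q : Fin n → ℝ) : LocallyUniform (inducedOrientation M q) := by
  have outgoing : ∀ (B : Finset (Fin n)) (i j : Fin n), i ≠ j → i ∉ B → j ∉ B →
      lcpVal M q B i < 0 → lcpVal M q B j < 0 → lcpVal M q (insert i B) j < 0 := by
    intro B i j hij hi hj hxi hxj
    have h1 := hM.2.lcpVal_pivot_of_ne q hi hij.symm
    have h2 := hM.lcpVal_neg_col_nonneg B hi hj hij.symm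
    have h3 : 0 ≤ lcpVal M q (insert i B) i :=
      not_lt.1 fun h => hxi.not_gt ((hM.2.lcpVal_insert_self_neg_iff q hi).1 h)
    have := mul_nonneg h3 h2
    linarith
  have incoming : ∀ (B : Finset (Fin n)) (i j : Fin n), i ≠ j → i ∉ B → j ∉ B →
      lcpVal M q (insert i B) i < 0 → lcpVal M q (insert j B) j < 0 →
      lcpVal M q (insert j (insert i B)) j < 0 := by
    intro B i j hij hi hj hyi hyj
    have h1 := hM.2.lcpVal_pivot_of_ne q hi hij.symm
    have h2 := hM.lcpVal_neg_col_nonneg B hi hj hij.symm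
    have hxj := (hM.2.lcpVal_insert_self_neg_iff q hj).1 hyj
    have hj' : j ∉ insert i B := by simp [hj, hij.symm]
    rw [hM.2.lcpVal_insert_self_neg_iff q hj']
    have := mul_nonpos_of_nonpos_of_nonneg hyi.le h2
    linarith
  constructor
  · intro u i j hij hi hj
    have hiB : i ∉ vertexBasis u := by simp [mem_vertexBasis, hi]
    have hjB : j ∉ vertexBasis u := by simp [mem_vertexBasis, hj]
    simp only [inducedOrientation, decide_eq_true_eq, vertexBasis_vflip hi, vertexBasis_vflip hj]
    exact fun hxi hxj => ⟨outgoing _ i j hij hiB hjB hxi hxj,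
      outgoing _ j i hij.symm hjB hiB hxj hxi⟩
  · intro u i j hij hi hj
    have hiB : i ∉ vertexBasis u := by simp [mem_vertexBasis, hi]
    have hjB : j ∉ vertexBasis u := by simp [mem_vertexBasis, hj]
    have hi' : vflip u j i = false := by rw [vflip_apply_of_ne u hij, hi]
    have hj' : vflip u i j = false := by rw [vflip_apply_of_ne u hij.symm, hj]
    simp only [inducedOrientation, decide_eq_true_eq, vertexBasis_vflip hi, vertexBasis_vflip hj,
      vertexBasis_vflip hi', vertexBasis_vflip hj']
    exact fun hyi hyj => ⟨incoming _ i j hij hiB hjB hyi hyj,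
      incoming _ j i hij.symm hjB hiB hyj hyi⟩

theorem IsPMatrix.isZMatrix_of_locallyUniform {n : ℕ} {M : Matrix (Fin n) (Fin n) ℝ}
    (hM : IsPMatrix M)
    (h : ∀ q : Fin n → ℝ, _root_.Nondegenerate M q → LocallyUniform (inducedOrientation M q)) :
    IsZMatrix M := by
  intro j i hji
  by_contra! hpos
  have hd : 0 < M i i := by
    have := hM.lcpVal_neg_col_self_neg (Finset.notMem_empty i)
    rw [lcpVal_empty] at this
    linarith
  let U : Set (Fin n → ℝ) := {q | q i < 0 ∧ q j < 0 ∧ q i * M j i < q j * M i i}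
  have hU : IsOpen U := by
    have h1 : IsOpen {q : Fin n → ℝ | q i < 0} := isOpen_lt (by fun_prop) (by fun_prop)
    have h2 : IsOpen {q : Fin n → ℝ | q j < 0} := isOpen_lt (by fun_prop) (by fun_prop)
    have h3 : IsOpen {q : Fin n → ℝ | q i * M j i < q j * M i i} :=
      isOpen_lt (by fun_prop) (by fun_prop)
    exact h1.inter (h2.inter h3)
  have hne : U.Nonempty := by
    refine ⟨fun s => if s = j then -M j i / 2 else -M i i, ?_, ?_, ?_⟩
    · simpa [hji.symm] using hd
    · simp only [if_true]; linarith
    · simp only [if_true, if_neg hji.symm]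
      nlinarith [mul_pos hd hpos]
  obtain ⟨q, ⟨hqi, hqj, hq⟩, hnd⟩ := hM.dense_setOf_nondegenerate.inter_open_nonempty U hU hne
  have hB : vertexBasis (fun _ : Fin n => false) = ∅ := by simp [vertexBasis]
  have hy := ((h q hnd).1 (fun _ => false) i j hji.symm rfl rfl
    (by simpa [inducedOrientation, hB, lcpVal_empty] using hqi)
    (by simpa [inducedOrientation, hB, lcpVal_empty] using hqj)).1
  rw [inducedOrientation, decide_eq_true_eq, vertexBasis_vflip rfl, hB] at hy
  have hself := hM.lcpVal_pivot_self q (Finset.notMem_empty i)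
  have hother := hM.lcpVal_pivot_of_ne q (Finset.notMem_empty i) hji
  simp only [lcpVal_empty] at hself hother
  have := mul_neg_of_neg_of_pos hy hd
  rw [hself, hother] at hq
  linarith

theorem stmt6 (n : ℕ) (M : Matrix (Fin n) (Fin n) ℝ) (hM : IsPMatrix M) :
    IsKMatrix M ↔
      ∀ q : Fin n → ℝ, Nondegenerate M q → LocallyUniform (inducedOrientation M q) := by
  exact ⟨fun hK q _ => hK.locallyUniform q, fun h => ⟨hM.isZMatrix_of_locallyUniform h, hM⟩⟩
end

section
/- Let φ be a unique-sink orientation of the n-cube. Then every subcube of the n-cube contains exactly one source with respect to φ (a vertex all of whose subcube edges are outgoing). -/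
open Matrix BigOperators

/-- Reversing all edges in a single coordinate direction preserves the unique-sink property. -/
theorem IsUSO.reverse_coord {n : ℕ} {φ : CubeOrientation n} (h : IsUSO φ) (i : Fin n) :
    IsUSO (fun v j => if j = i then !(φ v j) else φ v j) := by
  intro v C
  by_cases hi : i ∈ C
  · obtain ⟨s, ⟨hs, hs0⟩, hsu⟩ := h v C
    obtain ⟨t, ⟨ht, ht0⟩, htu⟩ := h (vflip s i) (C.erase i)
    have hti : t i = !(s i) := by
      simpa [vflip] using ht i (by simp)
    have htC : InSubcube v C t := by
      intro j hj
      have hji : j ≠ i := fun e => hj (e ▸ hi)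
      have := ht j (by simp [hj])
      simpa [vflip, hji, hs j hj] using this
    have htt : φ t i = true := by
      by_contra hf
      have : t = s := hsu t ⟨htC, fun j hj => by
        by_cases hji : j = i
        · subst hji; simpa using hf
        · exact ht0 j (Finset.mem_erase.2 ⟨hji, hj⟩)⟩
      simp [this] at hti
    refine ⟨t, ⟨htC, fun j hj => ?_⟩, ?_⟩
    · by_cases hji : j = i
      · simp [hji, htt]
      · simpa [hji] using ht0 j (Finset.mem_erase.2 ⟨hji, hj⟩)
    · rintro u ⟨hu, hu0⟩
      have hui : φ u i = true := by simpa using hu0 i hi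
      have hue : ∀ j ∈ C.erase i, φ u j = false := fun j hj => by
        simpa [Finset.ne_of_mem_erase hj] using hu0 j (Finset.mem_of_mem_erase hj)
      have hus : ∀ j, j ∉ C → u j = s j := fun j hj => (hu j hj).trans (hs j hj).symm
      by_cases hb : u i = s i
      · have : u = s := (h s (C.erase i)).unique
          ⟨fun j hj => by
            by_cases hji : j = i
            · rw [hji, hb]
            · exact hus j fun hjC => hj (Finset.mem_erase.2 ⟨hji, hjC⟩), hue⟩
          ⟨fun _ _ => rfl, fun j hj => hs0 j (Finset.mem_of_mem_erase hj)⟩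
        rw [this, hs0 i hi] at hui
        cases hui
      · refine htu u ⟨fun j hj => ?_, hue⟩
        by_cases hji : j = i
        · subst hji
          simpa [vflip] using Bool.eq_not_of_ne hb
        · simpa [vflip, hji] using hus j fun hjC => hj (Finset.mem_erase.2 ⟨hji, hjC⟩)
  · have hiff : ∀ u, IsSink (fun v j => if j = i then !(φ v j) else φ v j) v C u ↔
        IsSink φ v C u := fun u =>
      and_congr_right fun _ => forall₂_congr fun j hj => by
        have hji : j ≠ i := fun e => hi (e ▸ hj)
        simp [hji]
    simpa only [hiff] using h v C

/-- Reversing all edges in any set of coordinate directions preserves the unique-sink property. -/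
theorem IsUSO.reverse_coords {n : ℕ} {φ : CubeOrientation n} (h : IsUSO φ)
    (S : Finset (Fin n)) : IsUSO (fun v j => if j ∈ S then !(φ v j) else φ v j) := by
  induction S using Finset.induction_on with
  | empty => simpa using h
  | insert i S hi ih =>
    convert ih.reverse_coord i using 3 with v j
    by_cases hji : j = i
    · subst hji; simp [hi]
    · simp [hji]

theorem stmt10 (n : ℕ) (φ : CubeOrientation n) (h : IsUSO φ)
    (v : Vertex n) (C : Finset (Fin n)) :
    ∃! u, IsSource φ v C u := by
  simpa [IsSink, IsSource] using h.reverse_coords Finset.univ v C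
end

section
/- Let n ≥ 1 and let f : {0,1}^{n−1} → {0,1} be a monotone Boolean function. Then the orientation φ_f of the n-cube defined by: v → v⊕i whenever i ≠ n and v_i = 0, and v → v⊕n if and only if v_n + f(v') = 1 (where v' consists of the first n−1 bits of v), is a unique-sink orientation. Moreover, distinct monotone Boolean functions f yield distinct orientations φ_f. -/
open Matrix BigOperators

/-- The orientation `φ_f` of the `(n+1)`-cube built from a Boolean function
`f` on the first `n` bits: `v → v ⊕ i` for `i ≠ n` iff `v_i = 0`, and
`v → v ⊕ n` iff `v_n + f(v') = 1` where `v'` is the first `n` bits of `v`. -/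
def develinUSO {n : ℕ} (f : (Fin n → Bool) → Bool) : CubeOrientation (n + 1) :=
  fun v i =>
    if i = Fin.last n then (v (Fin.last n) != f (fun j => v j.castSucc))
    else !(v i)

/-- The value of `develinUSO f` on the last coordinate. -/
theorem develinUSO_last {n : ℕ} (f : (Fin n → Bool) → Bool) (v : Vertex (n + 1)) :
    develinUSO f v (Fin.last n) = (v (Fin.last n) != f (fun j => v j.castSucc)) := by
  simp [develinUSO]

/-- The value of `develinUSO f` on the other coordinates. -/
theorem develinUSO_castSucc {n : ℕ} (f : (Fin n → Bool) → Bool) (v : Vertex (n + 1))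
    (i : Fin n) : develinUSO f v i.castSucc = !(v i.castSucc) := by
  simp [develinUSO, Fin.castSucc_ne_last]

/-- A sink of `develinUSO f` in a subcube has its first bits set along the subcube, and its
last bit, if free, is the value of `f` at these. -/
theorem isSink_develinUSO_iff {n : ℕ} (f : (Fin n → Bool) → Bool) (v : Vertex (n + 1))
    (C : Finset (Fin (n + 1))) (u : Vertex (n + 1)) :
    IsSink (develinUSO f) v C u ↔
      (∀ j : Fin n, u j.castSucc = if j.castSucc ∈ C then true else v j.castSucc) ∧
      u (Fin.last n) =
        if Fin.last n ∈ C then f (fun j => u j.castSucc) else v (Fin.last n) := by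
  simp only [IsSink, InSubcube, Fin.forall_fin_succ', develinUSO_last, develinUSO_castSucc,
    Bool.not_eq_false', bne_eq_false_iff_eq]
  constructor
  · rintro ⟨⟨h1, h2⟩, h3, h4⟩
    exact ⟨fun j => by split_ifs with h <;> simp [*], by split_ifs with h <;> simp [*]⟩
  · rintro ⟨h1, h2⟩
    exact ⟨⟨fun j hj => by rw [h1, if_neg hj], fun hl => by rw [h2, if_neg hl]⟩,
      fun j hj => by rw [h1, if_pos hj], fun hl => by rw [h2, if_pos hl]⟩

/-- Every subcube has a unique sink under `develinUSO f`; monotonicity is not needed. -/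
theorem isUSO_develinUSO {n : ℕ} (f : (Fin n → Bool) → Bool) : IsUSO (develinUSO f) := by
  intro v C
  simp only [isSink_develinUSO_iff]
  let w : Fin n → Bool := fun j => if j.castSucc ∈ C then true else v j.castSucc
  refine ⟨Fin.snoc (α := fun _ => Bool) w (if Fin.last n ∈ C then f w else v (Fin.last n)),
    ⟨fun j => ?_, ?_⟩, ?_⟩
  · rw [Fin.snoc_castSucc]
  · simp only [Fin.snoc_castSucc, Fin.snoc_last]
  · rintro u ⟨h1, h2⟩
    have hw : (fun j : Fin n => u j.castSucc) = w := funext h1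
    rw [hw] at h2
    funext j
    refine Fin.lastCases ?_ (fun j => ?_) j
    · rw [Fin.snoc_last, h2]
    · rw [Fin.snoc_castSucc, h1]

/-- The Boolean function is recovered from the last coordinate of the orientation. -/
theorem develinUSO_injective (n : ℕ) : Function.Injective (develinUSO (n := n)) := by
  intro f g h
  funext x
  have key := congrFun (congrFun h (Fin.snoc (α := fun _ => Bool) x false)) (Fin.last n)
  simpa [develinUSO_last, Fin.snoc_castSucc, Fin.snoc_last] using key

theorem stmt12 (n : ℕ) :
    (∀ f : (Fin n → Bool) → Bool, Monotone f → IsUSO (develinUSO f)) ∧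
    (∀ f g : (Fin n → Bool) → Bool, Monotone f → Monotone g →
      develinUSO f = develinUSO g → f = g) :=
  ⟨fun f _ => isUSO_develinUSO f, fun _ _ _ _ h => develinUSO_injective n h⟩
end

section
/- Let n ≥ 1 and let f : {0,1}^{n−1} → {0,1} be a monotone Boolean function. Then the orientation φ_f of the n-cube defined by: v → v⊕i whenever i ≠ n and v_i = 0, and v → v⊕n if and only if v_n + f(v') = 1 (where v' consists of the first n−1 bits of v), is acyclic, i.e., contains no directed cycle. -/
open Matrix BigOperators

/-- A potential for `develinUSO f`: twice the number of ones among the first `n` bits, plus one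
if the last bit agrees with `f`. -/
def develinPotential {n : ℕ} (f : (Fin n → Bool) → Bool) (v : Vertex (n + 1)) : ℕ :=
  2 * ∑ j : Fin n, (v j.castSucc).toNat +
    (v (Fin.last n) == f (fun j => v j.castSucc)).toNat

theorem develinPotential_lt_of_orientStep {n : ℕ} {f : (Fin n → Bool) → Bool}
    {u w : Vertex (n + 1)} (h : OrientStep (develinUSO f) u w) :
    develinPotential f u < develinPotential f w := by
  obtain ⟨i, hi, rfl⟩ := h
  induction i using Fin.lastCases with
  | last =>
    have hne : u (Fin.last n) ≠ f (fun j => u j.castSucc) := by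
      simpa [develinUSO] using hi
    have hfirst : ∀ j : Fin n, vflip u (Fin.last n) j.castSucc = u j.castSucc := fun j =>
      Function.update_of_ne (Fin.castSucc_ne_last j) _ _
    have hlast : vflip u (Fin.last n) (Fin.last n) = f (fun j => u j.castSucc) := by
      simpa [vflip, Bool.not_eq_eq_eq_not, Bool.eq_not] using hne
    simp [develinPotential, hfirst, hlast, hne]
  | cast k =>
    have hk : u k.castSucc = false := by
      simpa [develinUSO, Fin.castSucc_ne_last] using hi
    have hsum : ∑ j : Fin n, (u j.castSucc).toNat <
        ∑ j : Fin n, (vflip u k.castSucc j.castSucc).toNat := by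
      refine Finset.sum_lt_sum (fun j _ => ?_) ⟨k, Finset.mem_univ k, by simp [vflip, hk]⟩
      by_cases hj : j = k
      · simp [hj, hk]
      · simp [vflip, hj]
    have hle := Bool.toNat_le (u (Fin.last n) == f (fun j => u j.castSucc))
    unfold develinPotential
    omega

theorem stmt13 (n : ℕ) (f : (Fin n → Bool) → Bool) (hf : Monotone f) :
    IsAcyclic (develinUSO f) := by
  intro u hu
  have hlt := hu.lift (p := (· < ·)) (develinPotential f)
    fun _ _ => develinPotential_lt_of_orientStep
  rw [Relation.transGen_eq_self] at hlt
  exact lt_irrefl _ hlt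
end

section
/- Let n ≥ 1 and let f : {0,1}^{n−1} → {0,1} be a monotone Boolean function. Then the orientation φ_f of the n-cube defined by: v → v⊕i whenever i ≠ n and v_i = 0, and v → v⊕n if and only if v_n + f(v') = 1 (where v' consists of the first n−1 bits of v), is a strongly Holt–Klee unique-sink orientation: for every F ⊆ [n], the orientation φ_f^{(F)} obtained by reversing all edges in coordinates in F is a USO in which every subcube of dimension d admits d directed paths from its source to its sink, no two of which share a vertex other than the source and the sink. -/
open Matrix BigOperators

/-! ### Directed paths in subcubes -/

theorem vflip_same {n : ℕ} (v : Vertex n) (i : Fin n) : vflip v i i = !(v i) := by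
  simp [vflip]

theorem vflip_of_ne {n : ℕ} (v : Vertex n) {i j : Fin n} (h : j ≠ i) : vflip v i j = v j := by
  simp [vflip, h]

theorem vflip_vflip {n : ℕ} (v : Vertex n) (i : Fin n) : vflip (vflip v i) i = v := by
  simp [vflip]

namespace IsDirPathIn

variable {n : ℕ} {φ : CubeOrientation n} {v w s t a : Vertex n} {C D : Finset (Fin n)}
  {p : List (Vertex n)}

theorem mono (h : IsDirPathIn φ w D s t p) (hDC : D ⊆ C) (hw : InSubcube v C w) :
    IsDirPathIn φ v C s t p := by
  obtain ⟨h1, h2, h3, h4, h5⟩ := h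
  refine ⟨h1, h2, h3, fun u hu j hj => ?_, ?_⟩
  · rw [h4 u hu j fun h => hj (hDC h), hw j hj]
  · exact List.IsChain.imp (fun x y ⟨i, hi, h⟩ => ⟨i, hDC hi, h⟩) h5

theorem cons (h : IsDirPathIn φ v C a t p) (hs : InSubcube v C s) (hsp : s ∉ p) {i : Fin n}
    (hi : i ∈ C) (hout : φ s i = true) (ha : a = vflip s i) :
    IsDirPathIn φ v C s t (s :: p) := by
  obtain ⟨h1, h2, h3, h4, h5⟩ := h
  refine ⟨rfl, ?_, List.nodup_cons.2 ⟨hsp, h3⟩, ?_, ?_⟩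
  · simp [List.getLast?_cons, h2]
  · simpa using ⟨hs, h4⟩
  · refine List.isChain_cons.2 ⟨fun y hy => ?_, h5⟩
    rw [h1] at hy
    obtain rfl : a = y := by simpa using hy
    exact ⟨i, hi, hout, ha⟩

theorem concat (h : IsDirPathIn φ v C s a p) (ht : InSubcube v C t) (htp : t ∉ p) {i : Fin n}
    (hi : i ∈ C) (hout : φ a i = true) (ha : t = vflip a i) :
    IsDirPathIn φ v C s t (p ++ [t]) := by
  obtain ⟨h1, h2, h3, h4, h5⟩ := h
  refine ⟨by simp [List.head?_append, h1], by simp, ?_, ?_, ?_⟩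
  · refine List.nodup_append.2 ⟨h3, by simp, ?_⟩
    rintro x hx y hy rfl
    exact htp (by simp at hy; exact hy ▸ hx)
  · intro u hu
    rcases List.mem_append.1 hu with hu | hu
    · exact h4 u hu
    · simp at hu; exact hu ▸ ht
  · refine List.isChain_append.2 ⟨h5, by simp, fun x hx y hy => ?_⟩
    rw [h2] at hx
    obtain rfl : a = x := by simpa using hx
    obtain rfl : t = y := by simpa using hy
    exact ⟨i, hi, hout, ha⟩

theorem of_fun {d : ℕ} (f : ℕ → Vertex n) (hs : f 0 = s) (ht : f d = t)
    (hinj : Set.InjOn f (Set.Iic d)) (hmem : ∀ j, InSubcube v C (f j))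
    (hstep : ∀ j < d, ∃ i ∈ C, φ (f j) i = true ∧ f (j + 1) = vflip (f j) i) :
    IsDirPathIn φ v C s t ((List.range (d + 1)).map f) := by
  refine ⟨?_, ?_, ?_, ?_, ?_⟩
  · simp [List.range_succ_eq_map, hs]
  · simp [List.range_succ, ht]
  · refine List.Nodup.map_on (fun x hx y hy h => hinj ?_ ?_ h) List.nodup_range
    · simpa [Nat.lt_succ_iff] using hx
    · simpa [Nat.lt_succ_iff] using hy
  · simp only [List.mem_map]
    rintro _ ⟨j, -, rfl⟩
    exact hmem j
  · refine List.isChain_iff_getElem.2 fun j hj => ?_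
    simp only [List.length_map, List.length_range] at hj
    simpa using hstep j (by omega)

end IsDirPathIn

/-! ### Cyclic families of paths -/

/-- The cyclic distance from `k` to `x` modulo `d`, for `k, x < d`. -/
def cyclicDist (d k x : ℕ) : ℕ := if k ≤ x then x - k else x + d - k

/-- The `j`-th vertex of the path which starts in `s` and flips the coordinates in `C` in the
cyclic order given by `pos`, starting with position `k`. -/
def cyclicVertex {n : ℕ} (s : Vertex n) (C : Finset (Fin n)) (pos : Fin n → ℕ) (k j : ℕ) :
    Vertex n :=
  fun i => if i ∈ C ∧ cyclicDist C.card k (pos i) < j then !(s i) else s i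

theorem cyclicVertex_eq_iff {n : ℕ} {s : Vertex n} {C : Finset (Fin n)} {pos : Fin n → ℕ}
    {k j l m : ℕ} : cyclicVertex s C pos k j = cyclicVertex s C pos l m ↔
      ∀ i ∈ C, (cyclicDist C.card k (pos i) < j ↔ cyclicDist C.card l (pos i) < m) := by
  constructor
  · intro h i hi
    have := congrFun h i
    simp only [cyclicVertex, hi, true_and] at this
    split_ifs at this <;> simp_all
    omega
  · intro h
    funext i
    by_cases hi : i ∈ C
    · simp [cyclicVertex, h i hi]
    · simp [cyclicVertex, hi]

/-- An injective assignment of positions below `C.card` to the elements of `C` is surjective. -/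
theorem exists_pos_eq {n : ℕ} {C : Finset (Fin n)} {pos : Fin n → ℕ}
    (hinj : Set.InjOn pos C) (hlt : ∀ i ∈ C, pos i < C.card) {x : ℕ} (hx : x < C.card) :
    ∃ i ∈ C, pos i = x := by
  have : C.image pos = Finset.range C.card := by
    apply Finset.eq_of_subset_of_card_le
    · intro y hy
      obtain ⟨i, hi, rfl⟩ := Finset.mem_image.1 hy
      exact Finset.mem_range.2 (hlt i hi)
    · rw [Finset.card_image_of_injOn hinj, Finset.card_range]
  have hx' := Finset.mem_range.2 hx
  rw [← this] at hx'
  simpa using hx'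

theorem exists_paths_of_cyclic {n : ℕ} {φ : CubeOrientation n} {v s t : Vertex n}
    {C : Finset (Fin n)} {pos : Fin n → ℕ}
    (hinj : Set.InjOn pos C) (hlt : ∀ i ∈ C, pos i < C.card)
    (hs : InSubcube v C s) (ht : ∀ i, t i = if i ∈ C then !(s i) else s i)
    (hout : ∀ k < C.card, ∀ i ∈ C,
      φ (cyclicVertex s C pos k (cyclicDist C.card k (pos i))) i = true) :
    ∃ P : Fin C.card → List (Vertex n),
      (∀ k, IsDirPathIn φ v C s t (P k)) ∧
      ∀ k l, k ≠ l → ∀ u, u ∈ P k → u ∈ P l → u = s ∨ u = t := by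
  have h0 : ∀ k, cyclicVertex s C pos k 0 = s := fun k => by
    funext i; simp [cyclicVertex]
  have hd : ∀ k < C.card, cyclicVertex s C pos k C.card = t := fun k hk => by
    funext i
    rw [ht i]
    by_cases hi : i ∈ C
    · have := hlt i hi
      have : cyclicDist C.card k (pos i) < C.card := by
        unfold cyclicDist; split_ifs <;> omega
      simp [cyclicVertex, hi, this]
    · simp [cyclicVertex, hi]
  have hsurj : ∀ k < C.card, ∀ j < C.card, ∃ i ∈ C, cyclicDist C.card k (pos i) = j := by
    intro k hk j hj
    obtain ⟨i, hi, hx⟩ := exists_pos_eq hinj hlt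
      (x := if k + j < C.card then k + j else k + j - C.card) (by split_ifs <;> omega)
    refine ⟨i, hi, ?_⟩
    unfold cyclicDist
    split_ifs at hx ⊢ <;> omega
  have hne : ∀ k l j m : ℕ, k < l → l < C.card → 0 < j → j < C.card →
      cyclicVertex s C pos k j ≠ cyclicVertex s C pos l m := by
    intro k l j m hkl hl hj hjd h
    rw [cyclicVertex_eq_iff] at h
    obtain ⟨a, ha, hak⟩ := exists_pos_eq hinj hlt (x := k) (by omega)
    obtain ⟨b, hb, hbk⟩ := exists_pos_eq hinj hlt
      (x := if k = 0 then C.card - 1 else k - 1) (by split_ifs <;> omega)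
    have h1 := h a ha
    have h2 := h b hb
    rw [hak] at h1
    rw [hbk] at h2
    unfold cyclicDist at h1 h2
    split_ifs at h1 h2 <;> omega
  refine ⟨fun k => (List.range (C.card + 1)).map (cyclicVertex s C pos k), fun k => ?_, ?_⟩
  · refine IsDirPathIn.of_fun _ (h0 k) (hd k k.2) ?_ ?_ ?_
    · have key : ∀ x y : ℕ, x < y → y ≤ C.card →
          cyclicVertex s C pos k x ≠ cyclicVertex s C pos k y := by
        intro x y hxy hy h
        obtain ⟨i, hi, hx⟩ := hsurj k k.2 x (by omega)
        have := cyclicVertex_eq_iff.1 h i hi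
        omega
      intro x hx y hy h
      simp only [Set.mem_Iic] at hx hy
      rcases lt_trichotomy x y with hxy | hxy | hxy
      · exact absurd h (key x y hxy hy)
      · exact hxy
      · exact absurd h.symm (key y x hxy hx)
    · intro j i hi
      simp [cyclicVertex, hi, hs i hi]
    · intro j hj
      obtain ⟨i, hi, hx⟩ := hsurj k k.2 j hj
      refine ⟨i, hi, hx ▸ hout k k.2 i hi, ?_⟩
      funext x
      by_cases hxi : x = i
      · subst hxi
        simp [vflip_same, cyclicVertex, hi, hx]
      · rw [vflip_of_ne _ hxi]
        by_cases hxC : x ∈ C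
        · have : cyclicDist C.card k (pos x) ≠ j := by
            intro h
            apply hxi
            apply hinj hxC hi
            have h1 := hlt x hxC
            have h2 := hlt i hi
            rw [← hx] at h
            unfold cyclicDist at h
            split_ifs at h <;> omega
          have : cyclicDist C.card k (pos x) < j + 1 ↔ cyclicDist C.card k (pos x) < j := by
            omega
          simp [cyclicVertex, this]
        · simp [cyclicVertex, hxC]
  · intro k l hkl u huk hul
    simp only [List.mem_map, List.mem_range] at huk hul
    obtain ⟨j, hj, rfl⟩ := huk
    obtain ⟨m, hm, h⟩ := hul
    by_contra! hcon
    have hj0 : j ≠ 0 := by rintro rfl; exact hcon.1 (h0 _)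
    have hjd : j ≠ C.card := by rintro rfl; exact hcon.2 (hd _ k.2)
    have hm0 : m ≠ 0 := by rintro rfl; exact hcon.1 (h ▸ h0 _)
    have hmd : m ≠ C.card := by rintro rfl; exact hcon.2 (h ▸ hd _ l.2)
    rcases lt_or_gt_of_ne (Fin.val_ne_of_ne hkl) with hlt' | hlt'
    · exact hne k l j m hlt' l.2 (by omega) (by omega) h.symm
    · exact hne l k m j hlt' k.2 (by omega) (by omega) h

/-- Positions in a finset, sorted by an injective key. -/
theorem exists_pos_of_key {α : Type*} (C : Finset α) (r : α → ℕ) (hr : Function.Injective r) :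
    ∃ pos : α → ℕ, Set.InjOn pos C ∧ (∀ i ∈ C, pos i < C.card) ∧
      ∀ i ∈ C, ∀ j ∈ C, r i < r j → pos i < pos j := by
  have hmono : ∀ i ∈ C, ∀ j ∈ C, r i < r j →
      (C.filter fun x => r x < r i).card < (C.filter fun x => r x < r j).card := by
    intro i hi j _ hij
    apply Finset.card_lt_card
    refine Finset.ssubset_iff_of_subset (fun x hx => ?_) |>.2 ⟨i, by simp [hi, hij], by simp⟩
    simp only [Finset.mem_filter] at hx ⊢
    exact ⟨hx.1, hx.2.trans hij⟩
  refine ⟨fun i => (C.filter fun x => r x < r i).card, ?_, ?_, hmono⟩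
  · intro i hi j hj h
    by_contra hne
    rcases lt_or_gt_of_ne (hr.ne hne) with h' | h'
    · exact (hmono i hi j hj h').ne h
    · exact (hmono j hj i hi h').ne' h
  · intro i hi
    apply Finset.card_lt_card
    exact Finset.ssubset_iff_of_subset (Finset.filter_subset _ _) |>.2 ⟨i, hi, by simp⟩

/-! ### Orientations that are uniform in all but the last coordinate -/

/-- The orientation in which every edge in a coordinate `i` other than the last points towards
the side `a i`, and the direction of the edges in the last coordinate is given by `g`. -/
def almostUniform {n : ℕ} (a : Fin (n + 1) → Bool) (g : (Fin n → Bool) → Bool) :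
    CubeOrientation (n + 1) :=
  fun v i =>
    if i = Fin.last n then (v (Fin.last n) != g (fun j => v j.castSucc)) else (v i != a i)

theorem reorient_develinUSO {n : ℕ} (f : (Fin n → Bool) → Bool) (F : Finset (Fin (n + 1))) :
    Reorient (develinUSO f) F = almostUniform (fun i => decide (i ∉ F))
      (fun x => f x ^^ decide (Fin.last n ∈ F)) := by
  funext v i
  have hc : ∀ j : Fin n, vflip v (Fin.last n) j.castSucc = v j.castSucc := fun j =>
    vflip_of_ne v (Fin.castSucc_ne_last j)
  by_cases hi : i = Fin.last n
  · subst hi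
    by_cases hF : Fin.last n ∈ F
    · simp only [Reorient, develinUSO, almostUniform, hF, if_true, hc, vflip_same, decide_true]
      cases v (Fin.last n) <;> cases f (fun j => v j.castSucc) <;> rfl
    · simp [Reorient, develinUSO, almostUniform, hF]
  · by_cases hF : i ∈ F
    · simp [Reorient, develinUSO, almostUniform, hF, hi, vflip_same]
    · simp [Reorient, develinUSO, almostUniform, hF, hi]

theorem isUSO_almostUniform {n : ℕ} (a : Fin (n + 1) → Bool) (g : (Fin n → Bool) → Bool) :
    IsUSO (almostUniform a g) := by
  intro v C
  let w : Fin n → Bool := fun j => if j.castSucc ∈ C then a j.castSucc else v j.castSucc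
  refine ⟨Fin.snoc (α := fun _ => Bool) w (if Fin.last n ∈ C then g w else v (Fin.last n)),
    ⟨fun j hj => ?_, fun i hi => ?_⟩, fun u hu => ?_⟩
  · induction j using Fin.lastCases with
    | last => simp [hj]
    | cast j => simp [w, hj]
  · induction i using Fin.lastCases with
    | last => simp [almostUniform, hi]
    | cast j => simp [almostUniform, w, hi]
  · have hw : ∀ j : Fin n, u j.castSucc = w j := fun j => by
      by_cases hj : j.castSucc ∈ C
      · simpa [almostUniform, w, hj] using hu.2 _ hj
      · simpa [w, hj] using hu.1 _ hj
    funext j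
    induction j using Fin.lastCases with
    | last =>
      by_cases hj : Fin.last n ∈ C
      · simpa [almostUniform, hj, hw] using hu.2 _ hj
      · simpa [hj] using hu.1 _ hj
    | cast j => simpa using hw j

theorem source_sink_apply {n : ℕ} {a : Fin (n + 1) → Bool} {g : (Fin n → Bool) → Bool}
    {v s t : Vertex (n + 1)} {C : Finset (Fin (n + 1))}
    (hs : IsSource (almostUniform a g) v C s) (ht : IsSink (almostUniform a g) v C t)
    {i : Fin (n + 1)} (hi : i ∈ C) (hin : i ≠ Fin.last n) : s i = (!a i) ∧ t i = a i := by
  have h1 := hs.2 i hi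
  have h2 := ht.2 i hi
  simp only [almostUniform, if_neg hin] at h1 h2
  refine ⟨?_, by simpa using h2⟩
  revert h1
  cases s i <;> cases a i <;> simp

theorem exists_paths_of_last_notMem {n : ℕ} {a : Fin (n + 1) → Bool} {g : (Fin n → Bool) → Bool}
    {v s t : Vertex (n + 1)} {C : Finset (Fin (n + 1))} (hC : Fin.last n ∉ C)
    (hs : IsSource (almostUniform a g) v C s) (ht : IsSink (almostUniform a g) v C t) :
    ∃ P : Fin C.card → List (Vertex (n + 1)),
      (∀ k, IsDirPathIn (almostUniform a g) v C s t (P k)) ∧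
      ∀ k l, k ≠ l → ∀ u, u ∈ P k → u ∈ P l → u = s ∨ u = t := by
  have hne : ∀ i ∈ C, i ≠ Fin.last n := fun i hi h => hC (h ▸ hi)
  obtain ⟨pos, hinj, hlt, -⟩ := exists_pos_of_key C Fin.val Fin.val_injective
  refine exists_paths_of_cyclic hinj hlt hs.1 (fun i => ?_) (fun k hk i hi => ?_)
  · by_cases hi : i ∈ C
    · obtain ⟨h1, h2⟩ := source_sink_apply hs ht hi (hne i hi)
      simp [hi, h1, h2]
    · simp [hi, hs.1 i hi, ht.1 i hi]
  · obtain ⟨h1, -⟩ := source_sink_apply hs ht hi (hne i hi)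
    simp [almostUniform, hne i hi, cyclicVertex, h1]

theorem Monotone.eq_of_forall_ne_imp_eq {ι : Type*} {f : (ι → Bool) → Bool} (hf : Monotone f)
    {x y : ι → Bool} {b : Bool} (hy : f y = b) (h : ∀ i, x i ≠ y i → x i = b) : f x = b := by
  cases b with
  | false =>
    have : x ≤ y := fun i => by
      by_cases hi : x i = y i
      · exact hi.le
      · rw [h i hi]; exact Bool.false_le _
    have := hf this
    rw [hy] at this
    exact le_antisymm this (Bool.false_le _)
  | true =>
    have : y ≤ x := fun i => by
      by_cases hi : x i = y i
      · exact hi.ge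
      · rw [h i hi]; exact Bool.le_true _
    have := hf this
    rw [hy] at this
    exact le_antisymm (Bool.le_true _) this

theorem exists_paths_of_eq {n : ℕ} {a : Fin (n + 1) → Bool} {f : (Fin n → Bool) → Bool}
    (hf : Monotone f) {c : Bool} {v s t : Vertex (n + 1)} {C : Finset (Fin (n + 1))}
    (hC : Fin.last n ∈ C)
    (hs : IsSource (almostUniform a fun x => f x ^^ c) v C s)
    (ht : IsSink (almostUniform a fun x => f x ^^ c) v C t)
    (hst : f (fun j => t j.castSucc) = f (fun j => s j.castSucc)) :
    ∃ P : Fin C.card → List (Vertex (n + 1)),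
      (∀ k, IsDirPathIn (almostUniform a fun x => f x ^^ c) v C s t (P k)) ∧
      ∀ k l, k ≠ l → ∀ u, u ∈ P k → u ∈ P l → u = s ∨ u = t := by
  obtain ⟨b, hb⟩ : ∃ b, f (fun j => s j.castSucc) = b := ⟨_, rfl⟩
  obtain ⟨pos, hinj, hlt, hpos⟩ := exists_pos_of_key C
    (fun i => (if i = Fin.last n then 2 * (n + 1) else if s i = b then 0 else n + 1) + i.val)
    (fun i j h => by
      ext
      have h1 := i.2
      have h2 := j.2
      simp only at h
      split_ifs at h <;> omega)
  have hs' := hs.2 _ hC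
  have ht' := ht.2 _ hC
  simp only [almostUniform, if_true, hst, hb] at hs' ht'
  refine exists_paths_of_cyclic hinj hlt hs.1 (fun i => ?_) (fun k hk i hi => ?_)
  · by_cases hi : i ∈ C
    · by_cases hin : i = Fin.last n
      · subst hin
        simp only [hi, if_true]
        revert hs' ht'
        cases t (Fin.last n) <;> cases s (Fin.last n) <;> cases b <;> cases c <;> simp
      · obtain ⟨h1, h2⟩ := source_sink_apply hs ht hi hin
        simp [hi, h1, h2]
    · simp [hi, hs.1 i hi, ht.1 i hi]
  · by_cases hin : i = Fin.last n
    · subst hin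
      have hpl : ∀ j ∈ C, j ≠ Fin.last n → pos j < pos (Fin.last n) := fun j hj hjl => by
        refine hpos j hj _ hi ?_
        have := j.2
        simp only [if_neg hjl, if_true]
        split_ifs <;> omega
      have hpb : ∀ i ∈ C, ∀ j ∈ C, i ≠ Fin.last n → j ≠ Fin.last n → s i = b → s j ≠ b →
          pos i < pos j := fun i hi j hj hil hjl hib hjb => by
        refine hpos i hi j hj ?_
        have := i.2
        simp only [if_neg hjl, if_neg hil, if_pos hib, if_neg hjb]
        omega
      have hkl : k ≤ pos (Fin.last n) := by
        obtain ⟨j, hj, hjk⟩ := exists_pos_eq hinj hlt hk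
        by_cases hjl : j = Fin.last n
        · rw [← hjk, hjl]
        · exact hjk ▸ (hpl j hj hjl).le
      have hval : ∀ j ∈ C, j ≠ Fin.last n →
          cyclicVertex s C pos k (cyclicDist C.card k (pos (Fin.last n))) j =
            if k ≤ pos j then !(s j) else s j := fun j hj hjl => by
        have h1 := hpl j hj hjl
        have h2 := hlt _ hi
        have : cyclicDist C.card k (pos j) < cyclicDist C.card k (pos (Fin.last n)) ↔
            k ≤ pos j := by
          unfold cyclicDist
          split_ifs <;> omega
        simp [cyclicVertex, hj, this]
      have hval' : ∀ j ∉ C,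
          cyclicVertex s C pos k (cyclicDist C.card k (pos (Fin.last n))) j = s j :=
        fun j hj => by simp [cyclicVertex, hj]
      have hfV : f (fun j => cyclicVertex s C pos k
          (cyclicDist C.card k (pos (Fin.last n))) j.castSucc) = b := by
        by_cases hcase : ∀ j ∈ C, j ≠ Fin.last n → k ≤ pos j → s j ≠ b
        · refine hf.eq_of_forall_ne_imp_eq hb fun j hj => ?_
          have hjl := Fin.castSucc_ne_last j
          by_cases hjC : j.castSucc ∈ C
          · rw [hval _ hjC hjl] at hj ⊢
            split_ifs at hj ⊢ with hk'
            · have := hcase _ hjC hjl hk'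
              revert this
              cases s j.castSucc <;> cases b <;> simp
            · exact absurd rfl hj
          · exact absurd (hval' _ hjC) hj
        · push Not at hcase
          obtain ⟨x, hxC, hxl, hkx, hxb⟩ := hcase
          refine hf.eq_of_forall_ne_imp_eq (hst.trans hb) fun j hj => ?_
          have hjl := Fin.castSucc_ne_last j
          by_cases hjC : j.castSucc ∈ C
          · obtain ⟨h1, h2⟩ := source_sink_apply hs ht hjC hjl
            rw [hval _ hjC hjl] at hj ⊢
            split_ifs at hj ⊢ with hk'
            · simp [h1, h2] at hj
            · by_contra hjb
              have := hpb x hxC _ hjC hxl hjl hxb hjb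
              omega
          · rw [hval' _ hjC, hs.1 _ hjC, ht.1 _ hjC] at hj
            exact absurd rfl hj
      have hlast : cyclicVertex s C pos k (cyclicDist C.card k (pos (Fin.last n))) (Fin.last n)
          = s (Fin.last n) := by simp [cyclicVertex]
      simp only [almostUniform, if_true, hlast, hfV]
      exact hs'
    · obtain ⟨h1, -⟩ := source_sink_apply hs ht hi hin
      simp [almostUniform, hin, cyclicVertex, h1]

theorem exists_paths_of_ne {n : ℕ} {a : Fin (n + 1) → Bool} {g : (Fin n → Bool) → Bool}
    {v s t : Vertex (n + 1)} {C : Finset (Fin (n + 1))} (hC : Fin.last n ∈ C)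
    (hs : IsSource (almostUniform a g) v C s) (ht : IsSink (almostUniform a g) v C t)
    (hst : g (fun j => t j.castSucc) ≠ g (fun j => s j.castSucc)) :
    ∃ P : Fin C.card → List (Vertex (n + 1)),
      (∀ k, IsDirPathIn (almostUniform a g) v C s t (P k)) ∧
      ∀ k l, k ≠ l → ∀ u, u ∈ P k → u ∈ P l → u = s ∨ u = t := by
  set D := C.erase (Fin.last n) with hD
  set φ := almostUniform a g with hφ
  have hDC : D ⊆ C := Finset.erase_subset _ _
  have hDl : Fin.last n ∉ D := Finset.notMem_erase _ _
  have hneD : ∀ i ∈ D, i ≠ Fin.last n := fun i hi h => hDl (h ▸ hi)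
  have hs' := hs.2 _ hC
  have ht' := ht.2 _ hC
  have hlast : t (Fin.last n) = s (Fin.last n) := by
    simp only [hφ, almostUniform, if_true] at hs' ht'
    revert hs' ht' hst
    cases t (Fin.last n) <;> cases s (Fin.last n) <;>
      cases g (fun j => t j.castSucc) <;> cases g (fun j => s j.castSucc) <;> simp
  have hoff : ∀ j, j ∉ D → t j = s j := fun j hj => by
    by_cases hjl : j = Fin.last n
    · rw [hjl, hlast]
    · have : j ∉ C := fun h => hj (Finset.mem_erase.2 ⟨hjl, h⟩)
      rw [hs.1 j this, ht.1 j this]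
  have hflip : ∀ u : Vertex (n + 1), ∀ i, i ≠ Fin.last n → φ (vflip u (Fin.last n)) i = φ u i :=
    fun u i hi => by simp [hφ, almostUniform, hi, vflip_of_ne]
  have hflipl : ∀ u : Vertex (n + 1),
      φ (vflip u (Fin.last n)) (Fin.last n) = !(φ u (Fin.last n)) := fun u => by
    have hc : ∀ j : Fin n, vflip u (Fin.last n) j.castSucc = u j.castSucc := fun j =>
      vflip_of_ne u (Fin.castSucc_ne_last j)
    simp only [hφ, almostUniform, if_true, vflip_same, hc]
    cases u (Fin.last n) <;> simp
  have hsD : IsSource φ s D s := ⟨fun _ _ => rfl, fun i hi => hs.2 i (hDC hi)⟩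
  have htD : IsSink φ s D t := ⟨hoff, fun i hi => ht.2 i (hDC hi)⟩
  have hsU : IsSource φ (vflip s (Fin.last n)) D (vflip s (Fin.last n)) :=
    ⟨fun _ _ => rfl, fun i hi => by rw [hflip _ _ (hneD i hi)]; exact hs.2 i (hDC hi)⟩
  have htU : IsSink φ (vflip s (Fin.last n)) D (vflip t (Fin.last n)) := by
    refine ⟨fun j hj => ?_, fun i hi => by rw [hflip _ _ (hneD i hi)]; exact ht.2 i (hDC hi)⟩
    by_cases hjl : j = Fin.last n
    · rw [hjl, vflip_same, vflip_same, hlast]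
    · rw [vflip_of_ne _ hjl, vflip_of_ne _ hjl, hoff j hj]
  have hst_ne : s ≠ t := fun h => hst (by rw [h])
  have hDpos : 0 < D.card := by
    refine Finset.card_pos.2 (Finset.nonempty_iff_ne_empty.2 fun h => hst_ne ?_)
    funext j
    exact (hoff j (by simp [h])).symm
  have hcard : D.card + 1 = C.card := Finset.card_erase_add_one hC
  obtain ⟨P, hP, hPd⟩ := exists_paths_of_last_notMem hDl hsD htD
  obtain ⟨Q, hQ, -⟩ := exists_paths_of_last_notMem hDl hsU htU
  generalize hq : Q ⟨0, hDpos⟩ = q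
  have hqp := hq ▸ hQ ⟨0, hDpos⟩
  have hql : ∀ u ∈ q, u (Fin.last n) = !(s (Fin.last n)) := fun u hu => by
    rw [hqp.2.2.2.1 u hu _ hDl, vflip_same]
  have hPl : ∀ k, ∀ u ∈ P k, u (Fin.last n) = s (Fin.last n) := fun k u hu =>
    (hP k).2.2.2.1 u hu _ hDl
  have hsq : s ∉ q := fun h => by simpa using hql s h
  have htq : t ∉ q := fun h => by simpa [hlast] using hql t h
  have hUC : InSubcube v C (vflip s (Fin.last n)) := fun j hj => by
    rw [vflip_of_ne _ (fun h : j = Fin.last n => hj (h ▸ hC)), hs.1 j hj]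
  have hext : IsDirPathIn φ v C s t (s :: (q ++ [t])) := by
    refine ((hqp.mono hDC hUC).concat ht.1 htq hC ?_ (vflip_vflip _ _).symm).cons hs.1 ?_ hC hs' rfl
    · rw [← hφ, hflipl, ht']; rfl
    · simp [hsq, hst_ne]
  have hdisj : ∀ k u, u ∈ P k → u ∈ s :: (q ++ [t]) → u = s ∨ u = t := by
    intro k u hu hu'
    simp only [List.mem_cons, List.mem_append, List.not_mem_nil, or_false] at hu'
    rcases hu' with h | h | h
    · exact Or.inl h
    · have h1 := hql u h
      rw [hPl k u hu] at h1
      simp at h1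
    · exact Or.inr h
  rw [← hcard]
  refine ⟨Fin.cons (s :: (q ++ [t])) P, fun k => ?_, fun k l => ?_⟩
  · induction k using Fin.cases with
    | zero => exact hext
    | succ k => exact (hP k).mono hDC hs.1
  · induction k using Fin.cases with
    | zero =>
      induction l using Fin.cases with
      | zero => exact fun h => absurd rfl h
      | succ l => exact fun _ u hu hu' => hdisj l u hu' hu
    | succ k =>
      induction l using Fin.cases with
      | zero => exact fun _ u hu hu' => hdisj k u hu hu'
      | succ l => exact fun h u hu hu' => hPd k l (fun h' => h (h' ▸ rfl)) u hu hu'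

theorem holtKlee_almostUniform {n : ℕ} (a : Fin (n + 1) → Bool) {f : (Fin n → Bool) → Bool}
    (hf : Monotone f) (c : Bool) : HoltKlee (almostUniform a fun x => f x ^^ c) := by
  refine ⟨isUSO_almostUniform _ _, fun v C s t hs ht => ?_⟩
  by_cases hC : Fin.last n ∈ C
  · by_cases hst : f (fun j => t j.castSucc) = f (fun j => s j.castSucc)
    · exact exists_paths_of_eq hf hC hs ht hst
    · exact exists_paths_of_ne hC hs ht (by simpa using hst)
  · exact exists_paths_of_last_notMem hC hs ht

theorem stmt15 (n : ℕ) (f : (Fin n → Bool) → Bool) (hf : Monotone f) :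
    IsUSO (develinUSO f) ∧ StronglyHoltKlee (develinUSO f) := by
  have h : StronglyHoltKlee (develinUSO f) := fun F => by
    rw [reorient_develinUSO]
    exact holtKlee_almostUniform _ hf _
  refine ⟨?_, h⟩
  have h0 : Reorient (develinUSO f) ∅ = develinUSO f := by
    funext v i
    simp [Reorient]
  exact h0 ▸ (h ∅).1
end
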